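/- Let K ⊂ ℝⁿ with γ_n(K) ≥ (1/2)e^{−εn} and K ⊂ 2√n·Bⁿ, and ε < 1/2. Then with probability at least 1 − e^{−εn} over a standard Gaussian Γ, for every subset I ⊂ [n] with |I| < εn, the support function of K(I) = K ∩ ⋂_{i∈I}{|x_i| ≤ 1} at Γ satisfies sup_{z∈K(I)} ⟨Γ, z⟩ > (1 − 32ε^{1/4}) n. -/

import Mathlib

open MeasureTheory Real
open scoped RealInnerProductSpace Pointwise

/-- The standard Gaussian measure on `ℝⁿ`. -/
noncomputable def gauss (n : ℕ) : Measure (EuclideanSpace ℝ (Fin n)) :=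
  volume.withDensity (fun x => ENNReal.ofReal ((2 * π) ^ (-(n : ℝ) / 2) * Real.exp (-‖x‖ ^ 2 / 2)))

/-- The Gaussian mean-width `w(K) = E[sup_{x ∈ K} ⟨Γ, x⟩]` of a set `K ⊆ ℝⁿ`. -/
noncomputable def meanWidth (n : ℕ) (K : Set (EuclideanSpace ℝ (Fin n))) : ℝ :=
  ∫ g, sSup ((fun x => ⟪g, x⟫) '' K) ∂(gauss n)

theorem bm_compact (A B C : Set ℝ) (hA : IsCompact A) (hB : IsCompact B) (hAn : A.Nonempty)
    (hBn : B.Nonempty) (h : ∀ x ∈ A, ∀ y ∈ B, (x + y) / 2 ∈ C) :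
    volume A + volume B ≤ 2 * volume C := by
  set a := sSup A with ha
  set b := sInf B with hb
  have haA : a ∈ A := hA.sSup_mem hAn
  have hbB : b ∈ B := hB.sInf_mem hBn
  have key : ∀ (S : Set ℝ) (t : ℝ), volume {c : ℝ | 2 * c - t ∈ S} = ENNReal.ofReal (2⁻¹) * volume S := by
    intro S t
    have h1 : {c : ℝ | 2 * c - t ∈ S} = (fun c => 2 * c) ⁻¹' ((fun c => c + (-t)) ⁻¹' S) := by
      ext c; simp [sub_eq_add_neg]
    rw [h1, Real.volume_preimage_mul_left (by norm_num), measure_preimage_add_right]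
    simp
  have hm1 : MeasurableSet {c : ℝ | 2 * c - a ∈ B} := by
    have : Measurable (fun c : ℝ => 2 * c - a) := by fun_prop
    exact this hB.measurableSet
  have hsub : {c : ℝ | 2 * c - b ∈ A} ∪ {c : ℝ | 2 * c - a ∈ B} ⊆ C := by
    rintro c (hc | hc)
    · have := h _ hc _ hbB
      simpa using this
    · have := h _ haA _ hc
      simpa using this
  have hdis : AEDisjoint volume {c : ℝ | 2 * c - b ∈ A} {c : ℝ | 2 * c - a ∈ B} := by
    have : {c : ℝ | 2 * c - b ∈ A} ∩ {c : ℝ | 2 * c - a ∈ B} ⊆ {(a + b) / 2} := by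
      rintro c ⟨h1, h2⟩
      have h3 := le_csSup hA.bddAbove h1
      have h4 := csInf_le hB.bddBelow h2
      simp only [Set.mem_singleton_iff]
      linarith
    exact measure_mono_null this (by simp)
  have h2 := measure_mono (μ := volume) hsub
  rw [measure_union₀ hm1.nullMeasurableSet hdis, key, key, ← mul_add] at h2
  have h3 : (2 : ENNReal) * ENNReal.ofReal (2⁻¹) = 1 := by
    rw [ENNReal.ofReal_inv_of_pos (by norm_num)]
    simp [ENNReal.mul_inv_cancel]
  calc volume A + volume B = 2 * (ENNReal.ofReal (2⁻¹) * (volume A + volume B)) := by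
        rw [← mul_assoc, h3, one_mul]
    _ ≤ _ := by gcongr

theorem bm_one (A B C : Set ℝ) (hA : MeasurableSet A) (hB : MeasurableSet B) (hAn : A.Nonempty)
    (hBn : B.Nonempty) (h : ∀ x ∈ A, ∀ y ∈ B, (x + y) / 2 ∈ C) :
    volume A + volume B ≤ 2 * volume C := by
  obtain ⟨a, ha⟩ := hAn
  obtain ⟨b, hb⟩ := hBn
  have step : ∀ K₁ ⊆ A, IsCompact K₁ → ∀ K₂ ⊆ B, IsCompact K₂ →
      volume K₁ + volume K₂ ≤ 2 * volume C := by
    intro K₁ h1 c1 K₂ h2 c2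
    calc volume K₁ + volume K₂ ≤ volume (insert a K₁) + volume (insert b K₂) := by
          gcongr <;> exact Set.subset_insert _ _
      _ ≤ _ := by
          apply bm_compact _ _ _ (c1.insert a) (c2.insert b) (Set.insert_nonempty _ _)
            (Set.insert_nonempty _ _)
          intro x hx y hy
          exact h x (Set.insert_subset ha h1 hx) y (Set.insert_subset hb h2 hy)
  have step2 : ∀ K₂ ⊆ B, IsCompact K₂ → volume A + volume K₂ ≤ 2 * volume C := by
    intro K₂ h2 c2
    have hle : volume K₂ ≤ 2 * volume C := by
      simpa using step ∅ (Set.empty_subset _) isCompact_empty K₂ h2 c2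
    have : volume A ≤ 2 * volume C - volume K₂ := by
      rw [hA.measure_eq_iSup_isCompact]
      refine iSup_le fun K₁ => iSup_le fun h1 => iSup_le fun c1 => ?_
      exact ENNReal.le_sub_of_add_le_right c2.measure_lt_top.ne (step K₁ h1 c1 K₂ h2 c2)
    calc volume A + volume K₂ ≤ (2 * volume C - volume K₂) + volume K₂ := by gcongr
      _ = _ := tsub_add_cancel_of_le hle
  have hle : volume A ≤ 2 * volume C := by
    simpa using step2 ∅ (Set.empty_subset _) isCompact_empty
  by_cases htop : volume A = ⊤
  · rw [htop, top_le_iff] at hle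
    rw [hle]; exact le_top
  have : volume B ≤ 2 * volume C - volume A := by
    rw [hB.measure_eq_iSup_isCompact]
    refine iSup_le fun K₂ => iSup_le fun h2 => iSup_le fun c2 => ?_
    exact ENNReal.le_sub_of_add_le_left htop (step2 K₂ h2 c2)
  calc volume A + volume B ≤ volume A + (2 * volume C - volume A) := by gcongr
    _ = _ := add_tsub_cancel_of_le hle

theorem layer (f : ℝ → ENNReal) (hf : Measurable f) (hf1 : ∀ x, f x ≤ 1) :
    ∫⁻ x, f x = ∫⁻ t in Set.Ioi (0 : ℝ), volume {x | t < (f x).toReal} := by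
  rw [← lintegral_eq_lintegral_meas_lt volume
    (Filter.Eventually.of_forall fun x => ENNReal.toReal_nonneg)
    hf.ennreal_toReal.aemeasurable]
  refine lintegral_congr fun x => ?_
  rw [ENNReal.ofReal_toReal (ne_top_of_le_ne_top ENNReal.one_ne_top (hf1 x))]

theorem pl_norm (f g h : ℝ → ENNReal) (hf : Measurable f) (hg : Measurable g) (hh : Measurable h)
    (hf1 : ∀ x, f x ≤ 1) (hg1 : ∀ x, g x ≤ 1) (hh1 : ∀ x, h x ≤ 1)
    (hfs : ⨆ x, f x = 1) (hgs : ⨆ x, g x = 1)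
    (hfgh : ∀ x y, f x * g y ≤ h ((x + y) / 2) ^ 2) :
    (∫⁻ x, f x) + (∫⁻ x, g x) ≤ 2 * ∫⁻ x, h x := by
  rw [layer f hf hf1, layer g hg hg1, layer h hh hh1]
  have anti : ∀ u : ℝ → ENNReal, Measurable fun t : ℝ => volume {x | t < (u x).toReal} := by
    intro u
    apply Antitone.measurable
    intro s t hst
    exact measure_mono fun x hx => lt_of_le_of_lt hst hx
  rw [← lintegral_add_left (anti f), ← lintegral_const_mul _ (anti h)]
  refine setLIntegral_mono ((anti h).const_mul _) ?_
  intro t ht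
  have ht0 : (0 : ℝ) < t := ht
  have fin : ∀ {u : ENNReal}, u ≤ 1 → u ≠ ⊤ := fun hu => ne_top_of_le_ne_top ENNReal.one_ne_top hu
  by_cases ht1 : t < 1
  · have ne : ∀ u : ℝ → ENNReal, (∀ x, u x ≤ 1) → ⨆ x, u x = 1 → {x | t < (u x).toReal}.Nonempty := by
      intro u hu hus
      have : ENNReal.ofReal t < ⨆ x, u x := by
        rw [hus]; simpa using ht1
      obtain ⟨x, hx⟩ := lt_iSup_iff.mp this
      exact ⟨x, (ENNReal.ofReal_lt_iff_lt_toReal ht0.le (fin (hu x))).mp hx⟩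
    apply bm_one _ _ _ (measurableSet_lt measurable_const hf.ennreal_toReal)
      (measurableSet_lt measurable_const hg.ennreal_toReal) (ne f hf1 hfs) (ne g hg1 hgs)
    intro x hx y hy
    simp only [Set.mem_ofPred_eq] at hx hy ⊢
    have h1 := ENNReal.toReal_mono (ENNReal.pow_ne_top (fin (hh1 _))) (hfgh x y)
    rw [ENNReal.toReal_mul, ENNReal.toReal_pow] at h1
    by_contra hcon
    push Not at hcon
    have h2 : (h ((x + y) / 2)).toReal ^ 2 ≤ t ^ 2 := by
      gcongr
    nlinarith
  · have z : ∀ u : ℝ → ENNReal, (∀ x, u x ≤ 1) → {x | t < (u x).toReal} = ∅ := by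
      intro u hu
      ext x
      simp only [Set.mem_ofPred_eq, Set.mem_empty_iff_false, iff_false, not_lt]
      have := ENNReal.toReal_mono ENNReal.one_ne_top (hu x)
      simp at this
      linarith
    simp [z f hf1, z g hg1]

theorem amgm (a b c : ENNReal) (h : a + b ≤ 2 * c) : a * b ≤ c ^ 2 := by
  by_cases hc : c = ⊤
  · simp [hc]
  have hc2 : 2 * c ≠ ⊤ := ENNReal.mul_ne_top (by simp) hc
  have hab := ne_top_of_le_ne_top hc2 h
  have ha : a ≠ ⊤ := fun h => hab (by simp [h])
  have hb : b ≠ ⊤ := fun h => hab (by simp [h])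
  lift a to NNReal using ha
  lift b to NNReal using hb
  lift c to NNReal using hc
  norm_cast at h ⊢
  have h' : (a : ℝ) + b ≤ 2 * c := by exact_mod_cast h
  have : (a : ℝ) * b ≤ c ^ 2 := by
    nlinarith [sq_nonneg ((a : ℝ) - b), a.2, b.2, c.2, NNReal.coe_nonneg a, NNReal.coe_nonneg b]
  exact_mod_cast this

theorem pl_bdd (f g h : ℝ → ENNReal) (hf : Measurable f) (hg : Measurable g) (hh : Measurable h)
    (hfs : ⨆ x, f x ≠ ⊤) (hgs : ⨆ x, g x ≠ ⊤)
    (hfgh : ∀ x y, f x * g y ≤ h ((x + y) / 2) ^ 2) :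
    (∫⁻ x, f x) * (∫⁻ x, g x) ≤ (∫⁻ x, h x) ^ 2 := by
  set M := ⨆ x, f x with hM
  set N := ⨆ x, g x with hN
  by_cases hM0 : M = 0
  · have : ∀ x, f x = 0 := by simpa [hM] using hM0
    simp [this]
  by_cases hN0 : N = 0
  · have : ∀ x, g x = 0 := by simpa [hN] using hN0
    simp [this]
  obtain ⟨c, hc⟩ : ∃ c : ENNReal, c ^ 2 = M * N := by
    refine ⟨(M * N) ^ (1 / 2 : ℝ), ?_⟩
    rw [← ENNReal.rpow_natCast, ← ENNReal.rpow_mul]; norm_num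
  have hMN : M * N ≠ ⊤ := ENNReal.mul_ne_top hfs hgs
  have hc0 : c ≠ 0 := by
    rintro rfl
    simp [hM0, hN0] at hc
  have hct : c ≠ ⊤ := by
    rintro rfl
    rw [← hc] at hMN
    simp at hMN
  have b1 : ∀ x, M⁻¹ * f x ≤ 1 := fun x => by
    calc M⁻¹ * f x ≤ M⁻¹ * M := by gcongr; exact le_iSup f x
      _ = 1 := ENNReal.inv_mul_cancel hM0 hfs
  have b2 : ∀ x, N⁻¹ * g x ≤ 1 := fun x => by
    calc N⁻¹ * g x ≤ N⁻¹ * N := by gcongr; exact le_iSup g x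
      _ = 1 := ENNReal.inv_mul_cancel hN0 hgs
  have hinv : M⁻¹ * N⁻¹ = c⁻¹ ^ 2 := by
    rw [← ENNReal.mul_inv (Or.inl hM0) (Or.inl hfs), ← hc, ENNReal.inv_pow]
  have key := pl_norm (fun x => M⁻¹ * f x) (fun x => N⁻¹ * g x) (fun x => min (c⁻¹ * h x) 1)
    (hf.const_mul _) (hg.const_mul _) ((hh.const_mul _).min measurable_const) b1 b2
    (fun x => min_le_right _ _)
    (by rw [← ENNReal.mul_iSup, ← hM, ENNReal.inv_mul_cancel hM0 hfs])
    (by rw [← ENNReal.mul_iSup, ← hN, ENNReal.inv_mul_cancel hN0 hgs])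
    (by
      intro x y
      have h1 : M⁻¹ * f x * (N⁻¹ * g y) ≤ (c⁻¹ * h ((x + y) / 2)) ^ 2 := by
        calc M⁻¹ * f x * (N⁻¹ * g y) = (M⁻¹ * N⁻¹) * (f x * g y) := by ring
          _ ≤ c⁻¹ ^ 2 * h ((x + y) / 2) ^ 2 := by rw [hinv]; gcongr; exact hfgh x y
          _ = _ := by ring
      have h2 : M⁻¹ * f x * (N⁻¹ * g y) ≤ 1 := by
        calc M⁻¹ * f x * (N⁻¹ * g y) ≤ 1 * 1 := by gcongr; exact b1 x; exact b2 y
          _ = 1 := by simp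
      rcases min_choice (c⁻¹ * h ((x + y) / 2)) 1 with h3 | h3
      · rw [h3]; exact h1
      · rw [h3]; simpa using h2)
  have key2 : (∫⁻ x, M⁻¹ * f x) + (∫⁻ x, N⁻¹ * g x) ≤ 2 * (c⁻¹ * ∫⁻ x, h x) := by
    refine key.trans ?_
    rw [← lintegral_const_mul _ hh]
    gcongr with x
    exact min_le_left _ _
  have key3 := amgm _ _ _ key2
  rw [lintegral_const_mul _ hf, lintegral_const_mul _ hg] at key3
  have hcc : c ^ 2 * c⁻¹ ^ 2 = 1 := by
    rw [← mul_pow, ENNReal.mul_inv_cancel hc0 hct, one_pow]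
  calc (∫⁻ x, f x) * (∫⁻ x, g x) = c ^ 2 * c⁻¹ ^ 2 * ((∫⁻ x, f x) * (∫⁻ x, g x)) := by
        rw [hcc, one_mul]
    _ = c ^ 2 * ((M⁻¹ * ∫⁻ x, f x) * (N⁻¹ * ∫⁻ x, g x)) := by rw [← hinv]; ring
    _ ≤ c ^ 2 * (c⁻¹ * ∫⁻ x, h x) ^ 2 := by gcongr
    _ = (c ^ 2 * c⁻¹ ^ 2) * (∫⁻ x, h x) ^ 2 := by ring
    _ = _ := by rw [hcc, one_mul]

theorem trunc (f : ℝ → ENNReal) (hf : Measurable f) :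
    ∫⁻ x, f x = ⨆ k : ℕ, ∫⁻ x, min (f x) k := by
  rw [← lintegral_iSup (fun k => hf.min measurable_const)]
  · refine lintegral_congr fun x => ?_
    apply le_antisymm
    · have : f x = min (f x) (⨆ k : ℕ, (k : ENNReal)) := by rw [ENNReal.iSup_natCast]; simp
      have h2 : min (f x) (⨆ k : ℕ, (k : ENNReal)) = ⨆ k : ℕ, min (f x) (k : ENNReal) :=
        inf_iSup_eq _ _
      exact (this.trans h2).le
    · exact iSup_le fun k => min_le_left _ _
  · intro i j hij x
    simp only
    gcongr

theorem pl_one (f g h : ℝ → ENNReal) (hf : Measurable f) (hg : Measurable g) (hh : Measurable h)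
    (hfgh : ∀ x y, f x * g y ≤ h ((x + y) / 2) ^ 2) :
    (∫⁻ x, f x) * (∫⁻ x, g x) ≤ (∫⁻ x, h x) ^ 2 := by
  rw [trunc f hf, trunc g hg, ENNReal.iSup_mul]
  refine iSup_le fun j => ?_
  rw [ENNReal.mul_iSup]
  refine iSup_le fun k => ?_
  refine pl_bdd _ _ h (hf.min measurable_const) (hg.min measurable_const) hh ?_ ?_ ?_
  · exact ne_top_of_le_ne_top (ENNReal.natCast_ne_top j) (iSup_le fun x => min_le_right _ _)
  · exact ne_top_of_le_ne_top (ENNReal.natCast_ne_top k) (iSup_le fun x => min_le_right _ _)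
  · intro x y
    refine le_trans ?_ (hfgh x y)
    gcongr <;> exact min_le_left _ _

theorem pl_pi (n : ℕ) : ∀ (f g h : (Fin n → ℝ) → ENNReal), Measurable f → Measurable g →
    Measurable h → (∀ x y, f x * g y ≤ h (fun i => (x i + y i) / 2) ^ 2) →
    (∫⁻ x, f x) * (∫⁻ x, g x) ≤ (∫⁻ x, h x) ^ 2 := by
  induction n with
  | zero =>
    intro f g h hf hg hh hfgh
    simp only [lintegral_unique, volume_pi, Measure.pi_empty_univ, mul_one]
    convert hfgh default default
  | succ n ih =>
    intro f g h hf hg hh hfgh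
    let e := (MeasurableEquiv.piFinSuccAbove (fun _ : Fin (n + 1) => ℝ) 0)
    have he := (volume_preserving_piFinSuccAbove (fun _ : Fin (n + 1) => ℝ) 0).symm
    have conv : ∀ u : (Fin (n + 1) → ℝ) → ENNReal, Measurable u →
        ∫⁻ x, u x = ∫⁻ s : ℝ, ∫⁻ v : Fin n → ℝ, u (Fin.cons s v) := by
      intro u hu
      rw [← he.lintegral_comp hu, Measure.volume_eq_prod, lintegral_prod _ (by
        exact (hu.comp (MeasurableEquiv.measurable _)).aemeasurable)]
      refine lintegral_congr fun s => lintegral_congr fun v => ?_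
      congr 1
      change Fin.insertNth (α := fun _ => ℝ) (0 : Fin (n + 1)) s v = _
      exact Fin.insertNth_zero' s v
    have cm : Measurable fun p : ℝ × (Fin n → ℝ) => (Fin.cons p.1 p.2 : Fin (n + 1) → ℝ) := by
      rw [measurable_pi_iff]
      intro i
      refine Fin.cases ?_ (fun j => ?_) i
      · simpa using measurable_fst
      · simp only [Fin.cons_succ]; fun_prop
    have mm : ∀ u : (Fin (n + 1) → ℝ) → ENNReal, Measurable u →
        Measurable fun s : ℝ => ∫⁻ v : Fin n → ℝ, u (Fin.cons s v) := by
      intro u hu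
      exact (hu.comp cm).lintegral_prod_right'
    rw [conv f hf, conv g hg, conv h hh]
    refine pl_one _ _ _ (mm f hf) (mm g hg) (mm h hh) ?_
    intro s t
    refine ih _ _ _ (hf.comp (cm.comp measurable_prodMk_left)) (hg.comp (cm.comp measurable_prodMk_left))
      (hh.comp (cm.comp measurable_prodMk_left)) ?_
    intro x y
    refine (hfgh _ _).trans (le_of_eq ?_)
    congr 2
    funext i
    refine Fin.cases ?_ (fun j => ?_) i <;> simp

theorem pl_euc (n : ℕ) (f g h : EuclideanSpace ℝ (Fin n) → ENNReal) (hf : Measurable f)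
    (hg : Measurable g) (hh : Measurable h)
    (hfgh : ∀ x y, f x * g y ≤ h ((1 / 2 : ℝ) • (x + y)) ^ 2) :
    (∫⁻ x, f x) * (∫⁻ x, g x) ≤ (∫⁻ x, h x) ^ 2 := by
  have hp := PiLp.volume_preserving_toLp (Fin n)
  rw [← hp.lintegral_comp hf, ← hp.lintegral_comp hg, ← hp.lintegral_comp hh]
  refine pl_pi n _ _ _ (hf.comp hp.measurable) (hg.comp hp.measurable) (hh.comp hp.measurable) ?_
  intro x y
  refine (hfgh _ _).trans (le_of_eq ?_)
  congr 2
  ext i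
  simp
  ring

/-- the Gaussian density -/
noncomputable def gd (n : ℕ) (x : EuclideanSpace ℝ (Fin n)) : ENNReal :=
  ENNReal.ofReal ((2 * π) ^ (-(n : ℝ) / 2) * Real.exp (-‖x‖ ^ 2 / 2))

theorem gd_meas (n : ℕ) : Measurable (gd n) := by
  unfold gd
  fun_prop

theorem gauss_apply (n : ℕ) (A : Set (EuclideanSpace ℝ (Fin n))) (hA : MeasurableSet A) :
    gauss n A = ∫⁻ x in A, gd n x := by
  rw [gauss, withDensity_apply _ hA]
  rfl

theorem gd_mul (n : ℕ) (x y : EuclideanSpace ℝ (Fin n)) (t : ℝ) (ht0 : 0 ≤ t)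
    (ht : t ≤ ‖x - y‖) : gd n x * gd n y ≤
      ENNReal.ofReal (Real.exp (-t ^ 2 / 4)) * gd n ((1 / 2 : ℝ) • (x + y)) ^ 2 := by
  unfold gd
  rw [← ENNReal.ofReal_mul (by positivity), ← ENNReal.ofReal_pow (by positivity),
    ← ENNReal.ofReal_mul (by positivity)]
  apply ENNReal.ofReal_le_ofReal
  set c := (2 * π) ^ (-(n : ℝ) / 2)
  have hc : 0 ≤ c := by positivity
  have h1 : ‖(1 / 2 : ℝ) • (x + y)‖ ^ 2 = ‖x + y‖ ^ 2 / 4 := by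
    rw [norm_smul, mul_pow]; norm_num; ring
  have h2 := parallelogram_law_with_norm ℝ x y
  rw [h1]
  have e1 : c * rexp (-‖x‖ ^ 2 / 2) * (c * rexp (-‖y‖ ^ 2 / 2)) =
      c ^ 2 * rexp (-‖x‖ ^ 2 / 2 + -‖y‖ ^ 2 / 2) := by rw [Real.exp_add]; ring
  have e2 : rexp (-t ^ 2 / 4) * (c * rexp (-(‖x + y‖ ^ 2 / 4) / 2)) ^ 2 =
      c ^ 2 * rexp (-t ^ 2 / 4 + (-(‖x + y‖ ^ 2 / 4) / 2 + -(‖x + y‖ ^ 2 / 4) / 2)) := by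
    rw [Real.exp_add, Real.exp_add]; ring
  rw [e1, e2]
  refine mul_le_mul_of_nonneg_left (Real.exp_le_exp.mpr ?_) (by positivity)
  have h3 : t ^ 2 ≤ ‖x - y‖ ^ 2 := by gcongr
  linarith

theorem plg (n : ℕ) (A B C : Set (EuclideanSpace ℝ (Fin n))) (hA : MeasurableSet A)
    (hB : MeasurableSet B) (hC : MeasurableSet C) (t : ℝ) (ht0 : 0 ≤ t)
    (hd : ∀ x ∈ A, ∀ y ∈ B, t ≤ ‖x - y‖) (hm : ∀ x ∈ A, ∀ y ∈ B, (1 / 2 : ℝ) • (x + y) ∈ C) :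
    gauss n A * gauss n B ≤ ENNReal.ofReal (Real.exp (-t ^ 2 / 4)) * gauss n C ^ 2 := by
  rw [gauss_apply n A hA, gauss_apply n B hB, gauss_apply n C hC, ← lintegral_indicator hA,
    ← lintegral_indicator hB, ← lintegral_indicator hC]
  set q := ENNReal.ofReal (Real.exp (-t ^ 2 / 8)) with hq
  have hq2 : ENNReal.ofReal (Real.exp (-t ^ 2 / 4)) = q ^ 2 := by
    rw [hq, ← ENNReal.ofReal_pow (by positivity), ← Real.exp_nat_mul]
    congr 2; push_cast; ring
  rw [hq2, ← mul_pow, ← lintegral_const_mul _ ((gd_meas n).indicator hC)]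
  refine pl_euc n _ _ _ ((gd_meas n).indicator hA) ((gd_meas n).indicator hB)
    (((gd_meas n).indicator hC).const_mul _) ?_
  intro x y
  by_cases hx : x ∈ A
  swap
  · simp [hx]
  by_cases hy : y ∈ B
  swap
  · simp [hy]
  rw [Set.indicator_of_mem hx, Set.indicator_of_mem hy, Set.indicator_of_mem (hm x hx y hy),
    mul_pow, ← hq2]
  exact gd_mul n x y t ht0 (hd x hx y hy)

theorem gauss_exp (n : ℕ) (θ : ℝ) (hθ : -1 < θ) :
    ∫⁻ x, ENNReal.ofReal (Real.exp (-θ * ‖x‖ ^ 2 / 2)) * gd n x =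
      ENNReal.ofReal ((1 + θ) ^ (-(n : ℝ) / 2)) := by
  have hb : 0 < (1 + θ) / 2 := by linarith
  have h1 := GaussianFourier.integral_rexp_neg_mul_sq_norm (V := EuclideanSpace ℝ (Fin n)) hb
  rw [finrank_euclideanSpace_fin] at h1
  have hint : Integrable (fun v : EuclideanSpace ℝ (Fin n) => rexp (-((1 + θ) / 2) * ‖v‖ ^ 2)) := by
    by_contra hcon
    rw [integral_undef hcon] at h1
    have : 0 < (π / ((1 + θ) / 2)) ^ ((n : ℝ) / 2) := by positivity
    linarith
  have h2 : ∀ x : EuclideanSpace ℝ (Fin n),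
      ENNReal.ofReal (Real.exp (-θ * ‖x‖ ^ 2 / 2)) * gd n x =
      ENNReal.ofReal ((2 * π) ^ (-(n : ℝ) / 2)) *
        ENNReal.ofReal (rexp (-((1 + θ) / 2) * ‖x‖ ^ 2)) := by
    intro x
    unfold gd
    rw [← ENNReal.ofReal_mul (by positivity), ← ENNReal.ofReal_mul (by positivity)]
    congr 1
    rw [mul_left_comm, ← Real.exp_add]
    congr 2; ring
  simp_rw [h2]
  rw [lintegral_const_mul _ (by fun_prop), ← ofReal_integral_eq_lintegral_ofReal hint
    (Filter.Eventually.of_forall fun x => (Real.exp_pos _).le), h1,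
    ← ENNReal.ofReal_mul (by positivity)]
  congr 1
  have h3 : π / ((1 + θ) / 2) = (2 * π) * (1 + θ)⁻¹ := by
    field_simp
  have hpos : 0 < 1 + θ := by linarith
  rw [h3, Real.mul_rpow (x := 2 * π) (y := (1 + θ)⁻¹) (by positivity) (by positivity), ← mul_assoc,
    ← Real.rpow_add (by positivity)]
  rw [show -(n : ℝ) / 2 + (n : ℝ) / 2 = 0 by ring, Real.rpow_zero, one_mul, Real.inv_rpow hpos.le,
    ← Real.rpow_neg hpos.le]
  congr 1; ring

instance gauss_prob (n : ℕ) : IsProbabilityMeasure (gauss n) := by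
  constructor
  rw [gauss_apply n _ MeasurableSet.univ, Measure.restrict_univ]
  have := gauss_exp n 0 (by norm_num)
  simpa using this

theorem gauss_lower (n : ℕ) (w : ℝ) (hw : 0 ≤ w) :
    gauss n {x | ‖x‖ ^ 2 ≤ n * Real.exp (-w)} ≤
      ENNReal.ofReal (Real.exp (-(n / 2) * (w + Real.exp (-w) - 1))) := by
  have hm : MeasurableSet {x : EuclideanSpace ℝ (Fin n) | ‖x‖ ^ 2 ≤ n * Real.exp (-w)} :=
    measurableSet_le (by fun_prop) measurable_const
  rw [gauss_apply n _ hm]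
  set θ := Real.exp w - 1 with hθ
  have hθ0 : 0 ≤ θ := by rw [hθ]; linarith [Real.add_one_le_exp w]
  calc ∫⁻ x in {x : EuclideanSpace ℝ (Fin n) | ‖x‖ ^ 2 ≤ n * Real.exp (-w)}, gd n x
      ≤ ∫⁻ x in {x : EuclideanSpace ℝ (Fin n) | ‖x‖ ^ 2 ≤ n * Real.exp (-w)},
        ENNReal.ofReal (Real.exp (θ * (n * Real.exp (-w)) / 2)) *
          (ENNReal.ofReal (Real.exp (-θ * ‖x‖ ^ 2 / 2)) * gd n x) := by
        refine setLIntegral_mono' hm fun x hx => ?_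
        rw [← mul_assoc, ← ENNReal.ofReal_mul (by positivity), ← Real.exp_add]
        refine le_mul_of_one_le_left zero_le ?_
        rw [ENNReal.one_le_ofReal, Real.one_le_exp_iff]
        have hx' : ‖x‖ ^ 2 ≤ n * Real.exp (-w) := hx
        nlinarith
    _ ≤ ∫⁻ x, ENNReal.ofReal (Real.exp (θ * (n * Real.exp (-w)) / 2)) *
          (ENNReal.ofReal (Real.exp (-θ * ‖x‖ ^ 2 / 2)) * gd n x) := setLIntegral_le_lintegral _ _
    _ = _ := by
        rw [lintegral_const_mul _ (by have := gd_meas n; fun_prop), gauss_exp n θ (by linarith),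
          ← ENNReal.ofReal_mul (by positivity)]
        congr 1
        rw [show 1 + θ = Real.exp w by rw [hθ]; ring, ← Real.exp_mul, ← Real.exp_add]
        congr 1
        have : Real.exp w * Real.exp (-w) = 1 := by rw [← Real.exp_add]; simp
        rw [hθ]
        linear_combination (n / 2 : ℝ) * this

theorem gauss_neg (n : ℕ) (A : Set (EuclideanSpace ℝ (Fin n))) (hA : MeasurableSet A) :
    gauss n (-A) = gauss n A := by
  rw [gauss_apply n _ hA.neg, gauss_apply n _ hA, ← lintegral_indicator hA.neg,
    ← lintegral_indicator hA, ← lintegral_neg_eq_self]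
  refine lintegral_congr fun x => ?_
  by_cases hx : x ∈ A
  · rw [Set.indicator_of_mem hx, Set.indicator_of_mem (by simpa using hx)]
    simp [gd]
  · rw [Set.indicator_of_notMem hx, Set.indicator_of_notMem (by simpa using hx)]

theorem sidak_one (n : ℕ) (K : Set (EuclideanSpace ℝ (Fin n))) (hK : Convex ℝ K) (hsym : K = -K)
    (hKm : MeasurableSet K) (i : Fin n) :
    gauss n K ≤ 6 * gauss n (K ∩ {x | |x i| ≤ 1}) := by
  set C := K ∩ {x : EuclideanSpace ℝ (Fin n) | |x i| ≤ 1} with hC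
  have hci : Measurable fun x : EuclideanSpace ℝ (Fin n) => x i := by fun_prop
  have hCm : MeasurableSet C := hKm.inter (measurableSet_le (by fun_prop) measurable_const)
  let A : ℕ → Set (EuclideanSpace ℝ (Fin n)) := fun k =>
    K ∩ ({x | (k : ℝ) ≤ x i} ∩ {x | x i ≤ (k : ℝ) + 1})
  have hAm : ∀ k, MeasurableSet (A k) := fun k =>
    hKm.inter ((measurableSet_le measurable_const hci).inter (measurableSet_le hci measurable_const))
  have hsub : K ⊆ ⋃ k : ℕ, (A k ∪ -(A k)) := by
    intro x hx
    refine Set.mem_iUnion.mpr ⟨⌊|x i|⌋₊, ?_⟩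
    have h1 := Nat.floor_le (abs_nonneg (x i))
    have h2 := (Nat.lt_floor_add_one (|x i|)).le
    have hx2 : -x ∈ K := by rw [hsym] at hx; simpa using hx
    rcases le_total 0 (x i) with h | h
    · left
      rw [abs_of_nonneg h] at *
      exact ⟨hx, h1, h2⟩
    · right
      rw [abs_of_nonpos h] at *
      exact ⟨hx2, by simpa using h1, by simpa using h2⟩
  have hAk : ∀ k, gauss n (A k) ≤ ENNReal.ofReal (2 / 3) ^ k * gauss n C := by
    intro k
    have h := plg n (A k) (-(A k)) C (hAm k) (hAm k).neg hCm (2 * k) (by positivity) ?_ ?_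
    · rw [gauss_neg n _ (hAm k), ← sq] at h
      have h3 : ENNReal.ofReal (rexp (-(2 * (k : ℝ)) ^ 2 / 4)) ≤ (ENNReal.ofReal (2 / 3) ^ k) ^ 2 := by
        rw [← ENNReal.ofReal_pow (by positivity), ← ENNReal.ofReal_pow (by positivity)]
        apply ENNReal.ofReal_le_ofReal
        have h4 : rexp (-1 / 2) ≤ 2 / 3 := by
          have h5 : rexp (-1 / 2) ^ 2 ≤ (2 / 3) ^ 2 := by
            rw [← Real.exp_nat_mul]
            norm_num
            rw [Real.exp_neg]
            have := Real.exp_one_gt_d9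
            rw [inv_le_comm₀ (by positivity) (by norm_num)]
            linarith
          exact (sq_le_sq₀ (by positivity) (by norm_num)).mp h5
        calc rexp (-(2 * (k : ℝ)) ^ 2 / 4) ≤ rexp ((k * 2 : ℕ) * (-1 / 2)) := by
              apply Real.exp_le_exp.mpr
              push_cast
              have : (k : ℝ) ≤ k ^ 2 := by exact_mod_cast Nat.le_self_pow (by norm_num) k
              linarith
          _ = rexp (-1 / 2) ^ (k * 2) := by rw [Real.exp_nat_mul]
          _ ≤ (2 / 3) ^ (k * 2) := by gcongr
          _ = _ := by rw [pow_mul]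
      have h5 : gauss n (A k) ^ 2 ≤ (ENNReal.ofReal (2 / 3) ^ k * gauss n C) ^ 2 := by
        rw [mul_pow]
        exact h.trans (by gcongr)
      exact (ENNReal.pow_le_pow_left_iff (by norm_num)).mp h5
    · rintro x ⟨_, hx, _⟩ y ⟨_, hy, _⟩
      have hx' : (k : ℝ) ≤ x i := hx
      have hy' : (k : ℝ) ≤ (-y) i := hy
      have h1 : |(x - y) i| ≤ ‖x - y‖ := by
        simpa using PiLp.norm_apply_le (x - y) i
      have h2 := le_abs_self ((x - y) i)
      simp at h1 h2 hy'
      linarith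
    · rintro x ⟨hxK, hx, hx1⟩ y ⟨hyK, hy, hy1⟩
      have hx' : (k : ℝ) ≤ x i := hx
      have hy' : (k : ℝ) ≤ (-y) i := hy
      have hx1' : x i ≤ (k : ℝ) + 1 := hx1
      have hy1' : (-y) i ≤ (k : ℝ) + 1 := hy1
      have hyK' : y ∈ K := by rw [hsym]; exact hyK
      constructor
      · have := hK hxK hyK' (a := 1 / 2) (b := 1 / 2) (by norm_num) (by norm_num) (by norm_num)
        rwa [← smul_add] at this
      · simp at hy' hy1'
        simp only [Set.mem_ofPred_eq, PiLp.smul_apply, PiLp.add_apply, smul_eq_mul]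
        rw [abs_le]
        constructor <;> linarith
  calc gauss n K ≤ gauss n (⋃ k : ℕ, (A k ∪ -(A k))) := measure_mono hsub
    _ ≤ ∑' k, gauss n (A k ∪ -(A k)) := measure_iUnion_le _
    _ ≤ ∑' k, ENNReal.ofReal (2 / 3) ^ k * (2 * gauss n C) := by
        refine ENNReal.tsum_le_tsum fun k => ?_
        refine (measure_union_le _ _).trans ?_
        rw [gauss_neg n _ (hAm k), ← two_mul, mul_left_comm]
        gcongr
        exact hAk k
    _ = 3 * (2 * gauss n C) := by
        rw [ENNReal.tsum_mul_right, ENNReal.tsum_geometric]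
        congr 1
        rw [← ENNReal.ofReal_one, ← ENNReal.ofReal_sub _ (by norm_num),
          ← ENNReal.ofReal_inv_of_pos (by norm_num)]
        norm_num
    _ = _ := by rw [← mul_assoc]; norm_num

theorem sidak (n : ℕ) (K : Set (EuclideanSpace ℝ (Fin n))) (hK : Convex ℝ K) (hsym : K = -K)
    (hKc : IsCompact K) (I : Finset (Fin n)) :
    gauss n K ≤ 6 ^ I.card * gauss n (K ∩ {x | ∀ i ∈ I, |x i| ≤ 1}) ∧
    Convex ℝ (K ∩ {x | ∀ i ∈ I, |x i| ≤ 1}) ∧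
    IsCompact (K ∩ {x | ∀ i ∈ I, |x i| ≤ 1}) ∧
    K ∩ {x | ∀ i ∈ I, |x i| ≤ 1} = -(K ∩ {x | ∀ i ∈ I, |x i| ≤ 1}) := by
  induction I using Finset.induction_on with
  | empty => simp [hK, hKc, ← hsym]
  | insert i I hi ih =>
    obtain ⟨h1, h2, h3, h4⟩ := ih
    have e : K ∩ {x : EuclideanSpace ℝ (Fin n) | ∀ j ∈ insert i I, |x j| ≤ 1} =
        (K ∩ {x | ∀ i ∈ I, |x i| ≤ 1}) ∩ {x | |x i| ≤ 1} := by
      ext x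
      simp only [Finset.mem_insert, forall_eq_or_imp, Set.mem_inter_iff, Set.mem_ofPred_eq]
      tauto
    rw [e]
    refine ⟨?_, ?_, ?_, ?_⟩
    · have := sidak_one n _ h2 h4 h3.measurableSet i
      rw [Finset.card_insert_of_notMem hi, pow_succ, mul_assoc]
      exact h1.trans (by gcongr)
    · refine h2.inter ?_
      intro x hx y hy a b ha hb hab
      have hx' : |x i| ≤ 1 := hx
      have hy' : |y i| ≤ 1 := hy
      rw [abs_le] at hx' hy'
      simp only [Set.mem_ofPred_eq, PiLp.smul_apply, PiLp.add_apply, smul_eq_mul]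
      rw [abs_le]
      constructor <;> nlinarith
    · refine h3.inter_right (isClosed_le (by fun_prop) continuous_const)
    · rw [Set.inter_neg, ← h4]
      congr 1
      ext x
      simp

theorem pade (w : ℝ) (hw : 0 ≤ w) : w ^ 2 / (2 + w) ≤ w + Real.exp (-w) - 1 := by
  have hmono : MonotoneOn (fun w : ℝ => (2 + w) * Real.exp (-w) + w - 2) (Set.Ici 0) := by
    apply monotoneOn_of_deriv_nonneg (convex_Ici 0)
    · fun_prop
    · fun_prop
    · intro x hx
      have hd : HasDerivAt (fun w : ℝ => (2 + w) * Real.exp (-w) + w - 2)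
          ((0 + 1) * Real.exp (-x) + (2 + x) * (Real.exp (-x) * (-1)) + 1) x := by
        have h1 : HasDerivAt (fun w : ℝ => (2 + w)) (0 + 1) x :=
          (hasDerivAt_const x (2 : ℝ)).add (hasDerivAt_id x)
        have h2 : HasDerivAt (fun w : ℝ => Real.exp (-w)) (Real.exp (-x) * (-1)) x :=
          (hasDerivAt_neg x).exp
        exact ((h1.mul h2).add (hasDerivAt_id x)).sub_const 2
      rw [hd.deriv]
      have h3 := Real.add_one_le_exp x
      have h4 : Real.exp x * Real.exp (-x) = 1 := by rw [← Real.exp_add]; simp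
      nlinarith [Real.exp_pos (-x)]
  have h := hmono (Set.mem_Ici.mpr le_rfl) (Set.mem_Ici.mpr hw) hw
  simp at h
  rw [div_le_iff₀ (by linarith)]
  nlinarith

theorem conc (n : ℕ) (hn : 0 < n) (L : Set (EuclideanSpace ℝ (Fin n))) (hL : IsCompact L)
    (u : ℝ) (hu0 : 0 < u) (hu : u ≤ 1 / 2) :
    gauss n L * gauss n ({x | n * (1 - u) < ‖x‖ ^ 2} ∩ {x | ∀ z ∈ L, ⟪x, z⟫ ≤ n * (1 - 2 * u)}) ≤
      ENNReal.ofReal (Real.exp (-(u ^ 2 * n / 4))) := by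
  have hcl : IsClosed {x : EuclideanSpace ℝ (Fin n) | ∀ z ∈ L, ⟪x, z⟫ ≤ n * (1 - 2 * u)} := by
    have : {x : EuclideanSpace ℝ (Fin n) | ∀ z ∈ L, ⟪x, z⟫ ≤ n * (1 - 2 * u)} =
        ⋂ z ∈ L, {x | ⟪x, z⟫ ≤ n * (1 - 2 * u)} := by ext; simp
    rw [this]
    exact isClosed_biInter fun z _ => isClosed_le (by fun_prop) continuous_const
  have hm : MeasurableSet ({x : EuclideanSpace ℝ (Fin n) | n * (1 - u) < ‖x‖ ^ 2} ∩
      {x | ∀ z ∈ L, ⟪x, z⟫ ≤ n * (1 - 2 * u)}) :=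
    (measurableSet_lt measurable_const (by fun_prop)).inter hcl.measurableSet
  have h := plg n L _ Set.univ hL.measurableSet hm MeasurableSet.univ (u * Real.sqrt n)
    (by positivity) ?_ (fun _ _ _ _ => Set.mem_univ _)
  · rw [measure_univ] at h
    refine h.trans (le_of_eq ?_)
    rw [mul_pow, Real.sq_sqrt (by positivity)]
    simp
    congr 1; ring
  · rintro y hy x ⟨hx1, hx2⟩
    have hx1' : n * (1 - u) < ‖x‖ ^ 2 := hx1
    have hx2' : ⟪x, y⟫ ≤ n * (1 - 2 * u) := hx2 y hy
    set N := Real.sqrt n with hN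
    have hN2 : N ^ 2 = n := Real.sq_sqrt (by positivity)
    have hnp : (0 : ℝ) < n := by exact_mod_cast hn
    have hN0 : 0 < N := Real.sqrt_pos.mpr hnp
    have h1 : ⟪x, x - y⟫ ≤ ‖x‖ * ‖x - y‖ := real_inner_le_norm _ _
    rw [inner_sub_right, real_inner_self_eq_norm_sq] at h1
    rw [norm_sub_rev]
    rw [← hN2] at hx1' hx2'
    have hr0 : 0 < ‖x‖ := by
      by_contra hc
      have : ‖x‖ = 0 := le_antisymm (not_lt.mp hc) (norm_nonneg _)
      rw [this] at hx1'
      nlinarith [sq_nonneg N]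
    have h2 : ‖x‖ * (u * N) ≤ ‖x‖ ^ 2 - N ^ 2 * (1 - 2 * u) := by
      rcases le_total ‖x‖ N with h | h
      · nlinarith [mul_le_mul_of_nonneg_left h (mul_pos hu0 hN0).le]
      · have h5 : N * (N * (1 - u)) ≤ ‖x‖ * (‖x‖ - u * N) := by
          apply mul_le_mul h _ _ hr0.le
          · nlinarith
          · have : 0 ≤ 1 - u := by linarith
            positivity
        nlinarith [mul_pos hu0 (mul_pos hN0 hN0)]
    have h3 : ‖x‖ * (u * N) ≤ ‖x‖ * ‖x - y‖ := by linarith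
    exact le_of_mul_le_mul_left h3 hr0

theorem count (n : ℕ) (q : ℝ) (hq : 0 < q) (hq1 : q ≤ 1) :
    (((Finset.univ : Finset (Finset (Fin n))).filter
      (fun I => (I.card : ℝ) < q ^ 4 * n)).card : ℝ) ≤ Real.exp (3 * (q ^ 2 * n)) := by
  set S := (Finset.univ : Finset (Finset (Fin n))).filter (fun I => (I.card : ℝ) < q ^ 4 * n)
  have hlog : -2 / q ^ 2 ≤ Real.log (q ^ 4) := by
    have h1 := Real.log_le_sub_one_of_pos (x := (q ^ 2)⁻¹) (by positivity)
    rw [Real.log_inv] at h1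
    have h2 : Real.log (q ^ 4) = 2 * Real.log (q ^ 2) := by
      rw [show q ^ 4 = (q ^ 2) ^ 2 by ring, Real.log_pow]; norm_num
    rw [h2, neg_div, div_eq_mul_inv]
    linarith
  have hpt : ∀ I ∈ S, (1 : ℝ) ≤ (q ^ 4) ^ I.card * Real.exp (2 * (q ^ 2 * n)) := by
    intro I hI
    have hc : (I.card : ℝ) < q ^ 4 * n := (Finset.mem_filter.mp hI).2
    have h1 : (q ^ 4) ^ I.card = Real.exp (I.card * Real.log (q ^ 4)) := by
      rw [Real.exp_nat_mul, Real.exp_log (by positivity)]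
    rw [h1, ← Real.exp_add, Real.one_le_exp_iff]
    have h2 : Real.log (q ^ 4) ≤ 0 := Real.log_nonpos (by positivity) (pow_le_one₀ hq.le hq1)
    have h3 : (q ^ 4 * n) * Real.log (q ^ 4) ≤ I.card * Real.log (q ^ 4) :=
      mul_le_mul_of_nonpos_right hc.le h2
    have h4 : (q ^ 4 * n) * (-2 / q ^ 2) ≤ (q ^ 4 * n) * Real.log (q ^ 4) := by gcongr
    have h5 : (q ^ 4 * n) * (-2 / q ^ 2) = -(2 * (q ^ 2 * n)) := by field_simp
    linarith
  calc (S.card : ℝ) = ∑ I ∈ S, (1 : ℝ) := by simp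
    _ ≤ ∑ I ∈ S, (q ^ 4) ^ I.card * Real.exp (2 * (q ^ 2 * n)) := Finset.sum_le_sum hpt
    _ ≤ ∑ I : Finset (Fin n), (q ^ 4) ^ I.card * Real.exp (2 * (q ^ 2 * n)) :=
        Finset.sum_le_sum_of_subset_of_nonneg (Finset.subset_univ _) (fun _ _ _ => by positivity)
    _ = (q ^ 4 + 1) ^ n * Real.exp (2 * (q ^ 2 * n)) := by
        rw [← Finset.sum_mul]
        congr 1
        have := Fintype.sum_pow_mul_eq_add_pow (Fin n) (q ^ 4) (1 : ℝ)
        simpa using this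
    _ ≤ (Real.exp (q ^ 4)) ^ n * Real.exp (2 * (q ^ 2 * n)) := by
        gcongr
        exact Real.add_one_le_exp _
    _ = Real.exp (n * q ^ 4 + 2 * (q ^ 2 * n)) := by rw [Real.exp_add, Real.exp_nat_mul]
    _ ≤ _ := by
        apply Real.exp_le_exp.mpr
        have : n * q ^ 4 ≤ n * q ^ 2 := by
          gcongr ?_ * ?_
          exact pow_le_pow_of_le_one hq.le hq1 (by norm_num)
        linarith

theorem exp_six : (6 : ℝ) ≤ Real.exp 2 := by
  have h := Real.exp_one_gt_d9
  have : Real.exp 2 = Real.exp 1 ^ 2 := by rw [← Real.exp_nat_mul]; norm_num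
  rw [this]
  nlinarith

theorem exp_three : (3 : ℝ) ≤ Real.exp (5 / 4) := by
  have h := Real.exp_one_gt_d9
  have h1 : Real.exp (5 / 4) ^ 4 = Real.exp 1 ^ 5 := by
    rw [← Real.exp_nat_mul, ← Real.exp_nat_mul]; norm_num
  have h2 : (3 : ℝ) ^ 4 ≤ Real.exp (5 / 4) ^ 4 := by
    rw [h1]
    calc (3 : ℝ) ^ 4 ≤ 2.7182818283 ^ 5 := by norm_num
      _ ≤ _ := by gcongr
  exact (pow_le_pow_iff_left₀ (by norm_num) (by positivity) (by norm_num)).mp h2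

theorem sup_ge (n : ℕ) (L : Set (EuclideanSpace ℝ (Fin n))) (hL : IsCompact L)
    (g z : EuclideanSpace ℝ (Fin n)) (hz : z ∈ L) :
    ⟪g, z⟫ ≤ sSup ((fun z => ⟪g, z⟫) '' L) := by
  apply le_csSup
  · exact (hL.image (by fun_prop)).bddAbove
  · exact ⟨z, hz, rfl⟩

theorem caseA (n : ℕ) (hn : 0 < n) (q : ℝ) (hq : 0 < q) (hq1 : 32 * q ≤ 1)
    (hx : 1 / 40 ≤ q ^ 2 * n)
    (K : Set (EuclideanSpace ℝ (Fin n))) (hK : Convex ℝ K) (hsym : K = -K)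
    (hKc : IsCompact K)
    (hKm : ENNReal.ofReal ((1 / 2) * Real.exp (-q ^ 4 * n)) ≤ gauss n K) :
    1 - ENNReal.ofReal (Real.exp (-q ^ 4 * n)) ≤
      gauss n {g | ∀ I : Finset (Fin n), (I.card : ℝ) < q ^ 4 * n →
        (1 - 32 * q) * n <
          sSup ((fun z => ⟪g, z⟫) '' (K ∩ {x | ∀ i ∈ I, |x i| ≤ 1}))} := by
  set G := {g : EuclideanSpace ℝ (Fin n) | ∀ I : Finset (Fin n), (I.card : ℝ) < q ^ 4 * n →
        (1 - 32 * q) * n <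
          sSup ((fun z => ⟪g, z⟫) '' (K ∩ {x | ∀ i ∈ I, |x i| ≤ 1}))} with hG
  set S := (Finset.univ : Finset (Finset (Fin n))).filter
      (fun I => (I.card : ℝ) < q ^ 4 * n) with hS
  set x := q ^ 2 * n with hxdef
  have hu0 : 0 < 16 * q := by positivity
  let F : Finset (Fin n) → Set (EuclideanSpace ℝ (Fin n)) := fun I =>
    {x | n * (1 - 16 * q) < ‖x‖ ^ 2} ∩
      {x | ∀ z ∈ (K ∩ {x | ∀ i ∈ I, |x i| ≤ 1}), ⟪x, z⟫ ≤ n * (1 - 2 * (16 * q))}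
  have hεx : q ^ 4 * n ≤ x := by
    rw [hxdef]
    gcongr ?_ * _
    exact pow_le_pow_of_le_one hq.le (by linarith) (by norm_num)
  have hbad : Gᶜ ⊆ {y | ‖y‖ ^ 2 ≤ n * Real.exp (-(16 * q))} ∪ ⋃ I ∈ S, F I := by
    intro g hg
    rw [hG, Set.mem_compl_iff, Set.mem_ofPred_eq] at hg
    push Not at hg
    obtain ⟨I, hI, hsup⟩ := hg
    by_cases hnorm : n * (1 - 16 * q) < ‖g‖ ^ 2
    · right
      refine Set.mem_biUnion (x := I) (by simpa [hS] using hI) ⟨hnorm, ?_⟩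
      intro z hz
      have := sup_ge n _ (sidak n K hK hsym hKc I).2.2.1 g z hz
      linarith
    · left
      have h1 := Real.one_sub_le_exp_neg (16 * q)
      have h2 : n * (1 - 16 * q) ≤ n * Real.exp (-(16 * q)) := by gcongr
      exact (not_lt.mp hnorm).trans h2
  have hFI : ∀ I ∈ S, gauss n (F I) ≤ ENNReal.ofReal (2 * Real.exp (3 * x - 64 * x)) := by
    intro I hI
    have hc : (I.card : ℝ) < q ^ 4 * n := (Finset.mem_filter.mp hI).2
    obtain ⟨h1, -, h3, -⟩ := sidak n K hK hsym hKc I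
    have h4 := conc n hn _ h3 (16 * q) hu0 (by linarith)
    have h6 : (6 : ENNReal) ^ I.card ≤ ENNReal.ofReal (Real.exp (2 * x)) := by
      have : (6 : ENNReal) = ENNReal.ofReal 6 := by norm_num
      rw [this, ← ENNReal.ofReal_pow (by norm_num)]
      apply ENNReal.ofReal_le_ofReal
      calc (6 : ℝ) ^ I.card ≤ Real.exp 2 ^ I.card := by gcongr; exact exp_six
        _ = Real.exp (I.card * 2) := by rw [Real.exp_nat_mul]
        _ ≤ _ := by apply Real.exp_le_exp.mpr; linarith
    have h5 : ENNReal.ofReal ((1 / 2) * Real.exp (-q ^ 4 * n)) * gauss n (F I) ≤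
        ENNReal.ofReal (Real.exp (2 * x)) * ENNReal.ofReal (Real.exp (-((16 * q) ^ 2 * n / 4))) := by
      calc _ ≤ (6 ^ I.card * gauss n (K ∩ {x | ∀ i ∈ I, |x i| ≤ 1})) * gauss n (F I) := by
            gcongr
            exact hKm.trans h1
        _ = 6 ^ I.card * (gauss n (K ∩ {x | ∀ i ∈ I, |x i| ≤ 1}) * gauss n (F I)) := by ring
        _ ≤ _ := by
          gcongr
    rw [← ENNReal.ofReal_toReal (measure_ne_top (gauss n) (F I))] at h5 ⊢
    rw [← ENNReal.ofReal_mul (by positivity), ← ENNReal.ofReal_mul (by positivity),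
      ENNReal.ofReal_le_ofReal_iff (by positivity), ← Real.exp_add] at h5
    apply ENNReal.ofReal_le_ofReal
    set p := (gauss n (F I)).toReal
    have e1 : 2 * x + -((16 * q) ^ 2 * n / 4) = (3 * x - 64 * x) + (-x) := by
      rw [hxdef]; ring
    rw [e1, Real.exp_add] at h5
    have hp : 0 ≤ p := ENNReal.toReal_nonneg
    have h7 : Real.exp (-x) ≤ Real.exp (-q ^ 4 * n) := by
      apply Real.exp_le_exp.mpr; linarith
    have h8 : Real.exp (-x) * p ≤ Real.exp (-x) * (2 * Real.exp (3 * x - 64 * x)) := by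
      nlinarith
    exact le_of_mul_le_mul_left h8 (Real.exp_pos _)
  have hlow : gauss n {y | ‖y‖ ^ 2 ≤ n * Real.exp (-(16 * q))} ≤
      ENNReal.ofReal (Real.exp (-(51 * x))) := by
    refine (gauss_lower n (16 * q) hu0.le).trans ?_
    apply ENNReal.ofReal_le_ofReal
    apply Real.exp_le_exp.mpr
    have h1 := pade (16 * q) hu0.le
    have h2 : (16 * q) ^ 2 * (2 / 5) ≤ (16 * q) ^ 2 / (2 + 16 * q) := by
      rw [le_div_iff₀ (by positivity)]
      have h0 : (2 / 5) * (2 + 16 * q) ≤ 1 := by linarith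
      have h00 := mul_le_mul_of_nonneg_left h0 (sq_nonneg (16 * q))
      linarith
    have h3 : (n / 2 : ℝ) * ((16 * q) ^ 2 * (2 / 5)) ≤
        (n / 2 : ℝ) * (16 * q + Real.exp (-(16 * q)) - 1) := by
      gcongr
      linarith
    have h4 : (n / 2 : ℝ) * ((16 * q) ^ 2 * (2 / 5)) = 51.2 * x := by rw [hxdef]; ring
    linarith
  have hcount := count n q hq (by linarith)
  have hbm : gauss n Gᶜ ≤ ENNReal.ofReal (Real.exp (-q ^ 4 * n)) := by
    calc gauss n Gᶜ ≤ gauss n ({y | ‖y‖ ^ 2 ≤ n * Real.exp (-(16 * q))} ∪ ⋃ I ∈ S, F I) :=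
          measure_mono hbad
      _ ≤ gauss n {y | ‖y‖ ^ 2 ≤ n * Real.exp (-(16 * q))} + gauss n (⋃ I ∈ S, F I) :=
          measure_union_le _ _
      _ ≤ ENNReal.ofReal (Real.exp (-(51 * x))) + ∑ I ∈ S, gauss n (F I) := by
          gcongr
          exact measure_biUnion_finset_le _ _
      _ ≤ ENNReal.ofReal (Real.exp (-(51 * x))) +
          ∑ I ∈ S, ENNReal.ofReal (2 * Real.exp (3 * x - 64 * x)) := by
          gcongr with I hI
          exact hFI I hI
      _ = ENNReal.ofReal (Real.exp (-(51 * x)) + S.card * (2 * Real.exp (3 * x - 64 * x))) := by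
          rw [Finset.sum_const, nsmul_eq_mul, ENNReal.ofReal_add (Real.exp_pos _).le
            (mul_nonneg (Nat.cast_nonneg _) (mul_nonneg two_pos.le (Real.exp_pos _).le)),
            ENNReal.ofReal_mul (p := (S.card : ℝ)) (Nat.cast_nonneg _), ENNReal.ofReal_natCast]
      _ ≤ _ := by
          apply ENNReal.ofReal_le_ofReal
          have h1 : S.card * (2 * Real.exp (3 * x - 64 * x)) ≤
              Real.exp (3 * x) * (2 * Real.exp (3 * x - 64 * x)) := by gcongr
          have h2 : Real.exp (3 * x) * (2 * Real.exp (3 * x - 64 * x)) =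
              2 * Real.exp (-(58 * x)) := by
            rw [mul_left_comm, ← Real.exp_add]; congr 2; ring
          have h3 : Real.exp (-(58 * x)) ≤ Real.exp (-(51 * x)) := by
            apply Real.exp_le_exp.mpr; linarith
          have h4 : 3 * Real.exp (-(51 * x)) ≤ Real.exp (-x) := by
            calc 3 * Real.exp (-(51 * x)) ≤ Real.exp (50 * x) * Real.exp (-(51 * x)) := by
                  gcongr
                  exact exp_three.trans (Real.exp_le_exp.mpr (by linarith))
              _ = _ := by rw [← Real.exp_add]; congr 1; ring
          have h5 : Real.exp (-x) ≤ Real.exp (-q ^ 4 * n) := by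
            apply Real.exp_le_exp.mpr; linarith
          linarith
  rw [tsub_le_iff_right]
  calc (1 : ENNReal) = gauss n (G ∪ Gᶜ) := by rw [Set.union_compl_self, measure_univ]
    _ ≤ gauss n G + gauss n Gᶜ := measure_union_le _ _
    _ ≤ _ := by gcongr

theorem inv_image (n : ℕ) (R : ℝ) (hR : 0 < R) (S : Set (EuclideanSpace ℝ (Fin n)))
    (hS : MeasurableSet S) (hS0 : ∀ y ∈ S, y ≠ 0) (c : ENNReal)
    (hc : ∀ y ∈ S, c * gd n y ≤
      ENNReal.ofReal (((R / ‖y‖) ^ 2) ^ n) * gd n (EuclideanGeometry.inversion 0 R y)) :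
    c * gauss n S ≤ gauss n (EuclideanGeometry.inversion 0 R '' S) := by
  have hd : ∀ y ∈ S, HasFDerivWithinAt (EuclideanGeometry.inversion (0 : EuclideanSpace ℝ (Fin n)) R)
      (((R / dist y 0) ^ 2 • (ℝ ∙ (y - 0))ᗮ.reflection :
        EuclideanSpace ℝ (Fin n) →L[ℝ] EuclideanSpace ℝ (Fin n))) S y := by
    intro y hy
    exact (EuclideanGeometry.hasFDerivAt_inversion (hS0 y hy)).hasFDerivWithinAt
  have hinj : Set.InjOn (EuclideanGeometry.inversion (0 : EuclideanSpace ℝ (Fin n)) R) S :=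
    (EuclideanGeometry.inversion_injective (0 : EuclideanSpace ℝ (Fin n)) hR.ne').injOn
  have h1 := lintegral_image_eq_lintegral_abs_det_fderiv_mul volume hS hd hinj (gd n)
  have hm : MeasurableSet (EuclideanGeometry.inversion (0 : EuclideanSpace ℝ (Fin n)) R '' S) :=
    measurable_image_of_fderivWithin hS hd hinj
  rw [gauss_apply n _ hm, h1, gauss_apply n _ hS, ← lintegral_const_mul _ (gd_meas n)]
  refine setLIntegral_mono' hS fun y hy => ?_
  refine (hc y hy).trans (le_of_eq ?_)
  congr 2
  have hdet : (((R / dist y 0) ^ 2 • (ℝ ∙ (y - 0))ᗮ.reflection :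
        EuclideanSpace ℝ (Fin n) →L[ℝ] EuclideanSpace ℝ (Fin n))).det =
      ((R / dist y 0) ^ 2) ^ n * (-1) ^ Module.finrank ℝ ((ℝ ∙ (y - 0))ᗮᗮ : Submodule ℝ (EuclideanSpace ℝ (Fin n))) := by
    have := Submodule.det_reflection (𝕜 := ℝ) (ℝ ∙ (y - 0))ᗮ
    rw [ContinuousLinearMap.det, ContinuousLinearMap.toLinearMap_smul, LinearMap.det_smul, finrank_euclideanSpace_fin]
    congr 1
  rw [hdet, abs_mul, abs_pow (-1 : ℝ), abs_neg, abs_one, one_pow, mul_one, dist_zero_right,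
    abs_of_nonneg (by positivity)]

theorem sinh_bd (c θ : ℝ) (hc : 0 ≤ c) (h0 : 0 ≤ θ) (h1 : θ ≤ 1) :
    Real.sinh (θ * c) - θ * c ≤ θ ^ 2 * (Real.sinh c - c) := by
  have ha := Real.hasSum_sinh (θ * c)
  have hb := Real.hasSum_sinh c
  have ha' := (hasSum_nat_add_iff' 1).mpr ha
  have hb' := ((hasSum_nat_add_iff' 1).mpr hb).mul_left (θ ^ 2)
  simp only [Finset.range_one, Finset.sum_singleton, mul_zero, zero_add, pow_one,
    Nat.factorial_one, Nat.cast_one, div_one] at ha' hb'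
  refine hasSum_le (fun k => ?_) ha' hb'
  rw [mul_pow, mul_div_assoc]
  gcongr ?_ * _
  exact pow_le_pow_of_le_one h0 h1 (by omega)

theorem sinh_num : Real.sinh (14 / 5) - 14 / 5 ≤ 5.45 := by
  have h := Real.exp_one_lt_d9
  have h1 : Real.exp (14 / 5) ≤ 16.5 := by
    have h2 : Real.exp (14 / 5) ^ 5 ≤ (16.5 : ℝ) ^ 5 := by
      rw [← Real.exp_nat_mul, show ((5 : ℕ) : ℝ) * (14 / 5) = (14 : ℕ) * 1 by norm_num,
        Real.exp_nat_mul]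
      calc Real.exp 1 ^ 14 ≤ 2.7182818286 ^ 14 := by gcongr
        _ ≤ _ := by norm_num
    exact (pow_le_pow_iff_left₀ (by positivity) (by norm_num) (by norm_num)).mp h2
  rw [Real.sinh_eq]
  linarith [Real.exp_pos (-(14 / 5))]

theorem exp_num1 : (1 / 250 : ℝ) ≤ Real.exp (-5.45) := by
  have h := Real.exp_one_lt_d9
  have h2 : Real.exp 5.45 ^ 20 ≤ (250 : ℝ) ^ 20 := by
    rw [← Real.exp_nat_mul, show ((20 : ℕ) : ℝ) * 5.45 = (109 : ℕ) * 1 by norm_num,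
      Real.exp_nat_mul]
    calc Real.exp 1 ^ 109 ≤ 2.7182818286 ^ 109 := by gcongr
      _ ≤ _ := by norm_num
  have h3 := (pow_le_pow_iff_left₀ (Real.exp_pos _).le (by norm_num) (by norm_num)).mp h2
  rw [Real.exp_neg, one_div]
  exact inv_anti₀ (Real.exp_pos _) h3

theorem exp_num2 : Real.exp (-0.81) ≤ (0.45 : ℝ) := by
  have h := Real.exp_one_gt_d9
  have h2 : (20 / 9 : ℝ) ^ 100 ≤ Real.exp 0.81 ^ 100 := by
    rw [← Real.exp_nat_mul, show ((100 : ℕ) : ℝ) * 0.81 = (81 : ℕ) * 1 by norm_num,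
      Real.exp_nat_mul]
    calc (20 / 9 : ℝ) ^ 100 ≤ 2.7182818283 ^ 81 := by norm_num
      _ ≤ _ := by gcongr
  have h3 := (pow_le_pow_iff_left₀ (by norm_num) (Real.exp_pos _).le (by norm_num)).mp h2
  rw [Real.exp_neg, show (0.45 : ℝ) = (20 / 9)⁻¹ by norm_num]
  exact inv_anti₀ (by norm_num) h3

theorem ratio (n : ℕ) (hn : 0 < n) (y : EuclideanSpace ℝ (Fin n))
    (h1 : n * Real.exp (-(14 / 5 / Real.sqrt n)) < ‖y‖ ^ 2) (h2 : ‖y‖ ^ 2 ≤ n) :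
    ENNReal.ofReal (Real.exp (-5.45)) * gd n y ≤
      ENNReal.ofReal (((Real.sqrt n / ‖y‖) ^ 2) ^ n) *
        gd n (EuclideanGeometry.inversion 0 (Real.sqrt n) y) := by
  have hnp : (1 : ℝ) ≤ n := by exact_mod_cast hn
  have hn0 : (0 : ℝ) < n := by linarith
  have hy2 : 0 < ‖y‖ ^ 2 := lt_trans (by positivity) h1
  set v := Real.log (n / ‖y‖ ^ 2) with hv
  have hev : Real.exp v = n / ‖y‖ ^ 2 := Real.exp_log (by positivity)
  have hyv : ‖y‖ ^ 2 = n * Real.exp (-v) := by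
    rw [Real.exp_neg, hev]; field_simp
  set N := Real.sqrt n with hN
  have hN2 : N ^ 2 = n := Real.sq_sqrt (by positivity)
  have hN1 : 1 ≤ N := Real.one_le_sqrt.mpr hnp
  have hv0 : 0 ≤ v := by
    apply Real.log_nonneg
    rw [le_div_iff₀ hy2]; linarith
  have hvw : v ≤ 14 / 5 / N := by
    rw [hyv] at h1
    have := lt_of_mul_lt_mul_left h1 hn0.le
    rw [Real.exp_lt_exp] at this
    linarith
  have hinv : ‖EuclideanGeometry.inversion 0 N y‖ ^ 2 = n * Real.exp v := by
    have := EuclideanGeometry.dist_inversion_center (0 : EuclideanSpace ℝ (Fin n)) y N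
    rw [dist_zero_right, dist_zero_right] at this
    rw [this, hev, hN2, div_pow]
    field_simp
  have hdet : ((N / ‖y‖) ^ 2) ^ n = Real.exp (n * v) := by
    rw [div_pow, hN2, ← hev, ← Real.exp_nat_mul]
  rw [hdet]
  unfold gd
  rw [hinv, hyv, ← ENNReal.ofReal_mul (by positivity), ← ENNReal.ofReal_mul (by positivity)]
  apply ENNReal.ofReal_le_ofReal
  rw [mul_left_comm, mul_left_comm (Real.exp (n * v)), ← Real.exp_add, ← Real.exp_add]
  refine mul_le_mul_of_nonneg_left (Real.exp_le_exp.mpr ?_) (by positivity)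
  have hθ : v / (14 / 5) ≤ 1 / N := by
    rw [div_le_iff₀ (by norm_num)]
    calc v ≤ _ := hvw
      _ = _ := by ring
  have hN' : 1 / N ≤ 1 := by rw [div_le_one (by linarith)]; exact hN1
  have hs := sinh_bd (14 / 5) (v / (14 / 5)) (by norm_num) (by positivity) (hθ.trans hN')
  rw [div_mul_cancel₀ _ (by norm_num)] at hs
  have hθ2 : n * (v / (14 / 5)) ^ 2 ≤ 1 := by
    have : (v / (14 / 5)) ^ 2 ≤ (1 / N) ^ 2 := by gcongr
    rw [div_pow 1 N, hN2] at this
    calc n * (v / (14 / 5)) ^ 2 ≤ n * (1 ^ 2 / n) := by gcongr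
      _ = 1 := by field_simp
  have hsn := sinh_num
  have hs0 : n * (Real.sinh v - v) ≤ 5.45 := by
    calc n * (Real.sinh v - v) ≤ n * ((v / (14 / 5)) ^ 2 * (Real.sinh (14 / 5) - 14 / 5)) := by
          gcongr
      _ ≤ n * ((v / (14 / 5)) ^ 2 * 5.45) := by gcongr
      _ = (n * (v / (14 / 5)) ^ 2) * 5.45 := by ring
      _ ≤ 1 * 5.45 := by gcongr
      _ = 5.45 := by norm_num
  rw [Real.sinh_eq] at hs0
  linarith

theorem caseB (n : ℕ) (hn : 0 < n) (q : ℝ) (hq : 0 < q) (hq1 : 32 * q ≤ 1)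
    (hx : q ^ 2 * n < 1 / 40)
    (K : Set (EuclideanSpace ℝ (Fin n))) (hKc : IsCompact K)
    (hKm : ENNReal.ofReal ((1 / 2) * Real.exp (-q ^ 4 * n)) ≤ gauss n K) :
    1 - ENNReal.ofReal (Real.exp (-q ^ 4 * n)) ≤
      gauss n {g | ∀ I : Finset (Fin n), (I.card : ℝ) < q ^ 4 * n →
        (1 - 32 * q) * n <
          sSup ((fun z => ⟪g, z⟫) '' (K ∩ {x | ∀ i ∈ I, |x i| ≤ 1}))} := by
  set G := {g : EuclideanSpace ℝ (Fin n) | ∀ I : Finset (Fin n), (I.card : ℝ) < q ^ 4 * n →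
        (1 - 32 * q) * n <
          sSup ((fun z => ⟪g, z⟫) '' (K ∩ {x | ∀ i ∈ I, |x i| ≤ 1}))} with hG
  have hnp : (1 : ℝ) ≤ n := by exact_mod_cast hn
  have hn0 : (0 : ℝ) < n := by linarith
  set t := q ^ 4 * n with ht
  have ht0 : 0 ≤ t := by positivity
  have ht1 : t ≤ 1 / 40960 := by
    have h1 : q ^ 2 ≤ (1 / 32) ^ 2 := by gcongr; linarith
    have h2 : t = q ^ 2 * (q ^ 2 * n) := by rw [ht]; ring
    rw [h2]
    calc q ^ 2 * (q ^ 2 * n) ≤ (1 / 32) ^ 2 * (1 / 40) := by gcongr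
      _ = _ := by norm_num
  set N := Real.sqrt n with hN
  have hN2 : N ^ 2 = n := Real.sq_sqrt (by positivity)
  have hN1 : 1 ≤ N := Real.one_le_sqrt.mpr hnp
  have hGmem : ∀ g : EuclideanSpace ℝ (Fin n), ∀ z ∈ K, (n : ℝ) ≤ ⟪g, z⟫ → g ∈ G := by
    intro g z hz hgz I hI
    have hI0 : I = ∅ := by
      have : (I.card : ℝ) < 1 := by linarith
      have : I.card < 1 := by exact_mod_cast this
      exact Finset.card_eq_zero.mp (by omega)
    subst hI0
    have hset : K ∩ {x : EuclideanSpace ℝ (Fin n) | ∀ i ∈ (∅ : Finset (Fin n)), |x i| ≤ 1} = K := by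
      ext; simp
    rw [hset]
    have := sup_ge n K hKc g z hz
    nlinarith
  set w := 14 / 5 / N with hw
  set S := K ∩ ({y | n * Real.exp (-w) < ‖y‖ ^ 2} ∩ {y | ‖y‖ ^ 2 ≤ n}) with hS
  set T := K ∩ {y | (n : ℝ) ≤ ‖y‖ ^ 2} with hT
  have hSm : MeasurableSet S := hKc.measurableSet.inter
    ((measurableSet_lt measurable_const (by fun_prop)).inter
      (measurableSet_le (by fun_prop) measurable_const))
  have hTG : T ⊆ G := by
    rintro y ⟨hy, hy2⟩
    refine hGmem y y hy ?_
    rw [real_inner_self_eq_norm_sq]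
    exact hy2
  have hS0 : ∀ y ∈ S, y ≠ 0 := by
    rintro y ⟨_, hy, _⟩ rfl
    have hy' : n * Real.exp (-w) < ‖(0 : EuclideanSpace ℝ (Fin n))‖ ^ 2 := hy
    rw [norm_zero] at hy'
    have : 0 < n * Real.exp (-w) := by positivity
    norm_num at hy'
    linarith
  have hSG : EuclideanGeometry.inversion 0 N '' S ⊆ G := by
    rintro _ ⟨y, hy, rfl⟩
    refine hGmem _ y hy.1 (le_of_eq ?_)
    have hy0 : ‖y‖ ≠ 0 := norm_ne_zero_iff.mpr (hS0 y hy)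
    rw [EuclideanGeometry.inversion]
    simp only [vsub_eq_sub, sub_zero, vadd_eq_add, add_zero, dist_zero_right]
    rw [real_inner_smul_left, real_inner_self_eq_norm_sq, div_pow, hN2]
    field_simp
  have hSi := inv_image n N (by linarith) S hSm hS0 (ENNReal.ofReal (Real.exp (-5.45)))
    (fun y hy => ratio n hn y hy.2.1 hy.2.2)
  have hlow : gauss n {x | ‖x‖ ^ 2 ≤ n * Real.exp (-w)} ≤ ENNReal.ofReal 0.45 := by
    have hw0 : 0 ≤ w := by positivity
    refine (gauss_lower n w hw0).trans (ENNReal.ofReal_le_ofReal ?_)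
    refine le_trans (Real.exp_le_exp.mpr ?_) exp_num2
    have h1 := pade w hw0
    have hw1 : w ≤ 14 / 5 := div_le_self (by norm_num) hN1
    have hw2 : n * w ^ 2 = 7.84 := by
      rw [hw, div_pow, hN2]; field_simp; norm_num
    have h2 : w ^ 2 / 4.8 ≤ w ^ 2 / (2 + w) := by
      apply div_le_div_of_nonneg_left (by positivity) (by positivity)
      norm_num; linarith
    have h3 : (n / 2 : ℝ) * (w ^ 2 / 4.8) ≤ (n / 2 : ℝ) * (w + Real.exp (-w) - 1) := by
      gcongr
      linarith
    have h4 : (n / 2 : ℝ) * (w ^ 2 / 4.8) = (n * w ^ 2) / 9.6 := by ring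
    rw [h4, hw2] at h3
    norm_num at h3 ⊢
    linarith
  have hcov : K ⊆ ({x | ‖x‖ ^ 2 ≤ n * Real.exp (-w)} ∪ S) ∪ T := by
    intro y hy
    by_cases h1 : (n : ℝ) ≤ ‖y‖ ^ 2
    · right; exact ⟨hy, h1⟩
    · left
      by_cases h2 : ‖y‖ ^ 2 ≤ n * Real.exp (-w)
      · left; exact h2
      · right; exact ⟨hy, not_le.mp h2, (not_le.mp h1).le⟩
  have hsum : ENNReal.ofReal ((1 / 2) * Real.exp (-q ^ 4 * n)) ≤
      ENNReal.ofReal 0.45 + gauss n S + gauss n G := by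
    calc _ ≤ gauss n K := hKm
      _ ≤ gauss n (({x | ‖x‖ ^ 2 ≤ n * Real.exp (-w)} ∪ S) ∪ T) := measure_mono hcov
      _ ≤ gauss n ({x | ‖x‖ ^ 2 ≤ n * Real.exp (-w)} ∪ S) + gauss n T := measure_union_le _ _
      _ ≤ gauss n {x | ‖x‖ ^ 2 ≤ n * Real.exp (-w)} + gauss n S + gauss n T := by
          gcongr
          exact measure_union_le _ _
      _ ≤ _ := by gcongr
  have hSG2 := hSi.trans (measure_mono hSG)
  have eG := ENNReal.ofReal_toReal (measure_ne_top (gauss n) G)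
  have eS := ENNReal.ofReal_toReal (measure_ne_top (gauss n) S)
  set g := (gauss n G).toReal
  set s := (gauss n S).toReal
  have hg0 : 0 ≤ g := ENNReal.toReal_nonneg
  have hs0 : 0 ≤ s := ENNReal.toReal_nonneg
  rw [← eG, ← eS] at hsum
  rw [← eG, ← eS, ← ENNReal.ofReal_mul (Real.exp_pos _).le, ENNReal.ofReal_le_ofReal_iff hg0]
    at hSG2
  rw [← ENNReal.ofReal_add (by norm_num) hs0, ← ENNReal.ofReal_add (by positivity) hg0,
    ENNReal.ofReal_le_ofReal_iff (by positivity)] at hsum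
  rw [← eG, ← ENNReal.ofReal_one, ← ENNReal.ofReal_sub _ (Real.exp_pos _).le]
  apply ENNReal.ofReal_le_ofReal
  have h5 : 1 - t ≤ Real.exp (-q ^ 4 * n) := by
    have := Real.one_sub_le_exp_neg t
    rwa [ht, ← neg_mul] at this
  have h6 : (1 / 250) * s ≤ g :=
    (mul_le_mul_of_nonneg_right exp_num1 hs0).trans hSG2
  generalize Real.exp (-q ^ 4 * n) = e at hsum h5 ⊢
  norm_num at hsum
  linarith

theorem stmt8 (n : ℕ) (ε : ℝ) (hε : 0 < ε) (hε2 : ε < 1 / 2)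
    (K : Set (EuclideanSpace ℝ (Fin n))) (hK : Convex ℝ K) (hsym : K = -K)
    (hKc : IsCompact K) (hKn : K.Nonempty)
    (hKb : K ⊆ Metric.closedBall 0 (2 * Real.sqrt n))
    (hKm : ENNReal.ofReal ((1 / 2) * Real.exp (-ε * n)) ≤ gauss n K) :
    1 - ENNReal.ofReal (Real.exp (-ε * n)) ≤
      gauss n {g | ∀ I : Finset (Fin n), (I.card : ℝ) < ε * n →
        (1 - 32 * ε ^ ((1 : ℝ) / 4)) * n <
          sSup ((fun z => ⟪g, z⟫) '' (K ∩ {x | ∀ i ∈ I, |x i| ≤ 1}))} := by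
  rcases Nat.eq_zero_or_pos n with h0 | hn
  · subst h0
    simp
  set q := ε ^ ((1 : ℝ) / 4) with hqd
  have hq : 0 < q := by positivity
  have hq4 : ε = q ^ 4 := by
    rw [hqd, ← Real.rpow_natCast, ← Real.rpow_mul hε.le]
    norm_num
  clear_value q
  subst hq4
  have hn0 : (0 : ℝ) < n := by exact_mod_cast hn
  rcases lt_or_ge 1 (32 * q) with h1 | h1
  · have hz : (0 : EuclideanSpace ℝ (Fin n)) ∈ K := by
      obtain ⟨x, hx⟩ := hKn
      have hx2 : -x ∈ K := by rw [hsym] at hx; simpa using hx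
      have := hK hx hx2 (a := 1 / 2) (b := 1 / 2) (by norm_num) (by norm_num) (by norm_num)
      simpa using this
    have huniv : {g | ∀ I : Finset (Fin n), (I.card : ℝ) < q ^ 4 * n →
        (1 - 32 * q) * n <
          sSup ((fun z => ⟪g, z⟫) '' (K ∩ {x | ∀ i ∈ I, |x i| ≤ 1}))} = Set.univ := by
      ext g
      simp only [Set.mem_ofPred_eq, Set.mem_univ, iff_true]
      intro I _
      have := sup_ge n _ (sidak n K hK hsym hKc I).2.2.1 g 0 ⟨hz, by simp⟩
      rw [inner_zero_right] at this
      nlinarith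
    rw [huniv, measure_univ]
    exact tsub_le_self
  · rcases le_or_gt (1 / 40) (q ^ 2 * n) with h2 | h2
    · exact caseA n hn q hq h1 h2 K hK hsym hKc hKm
    · exact caseB n hn q hq h1 h2 K hKc hKm
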